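/- Let L ∈ UC₋ and define f : ℝⁿ → (−∞,+∞] by f(x) = max{h_{L°}(x), −1} (so f(x) = +∞ exactly where h_{L°}(x) = +∞, i.e. for x outside R̄₋ⁿ). Then the Legendre transform of f is given by 𝓛[f](y) = max{h_L(y) + 1, 0} for every y ∈ ℝⁿ (both sides being +∞ for y outside R̄₊ⁿ). -/

import Mathlib

open Set MeasureTheory Pointwise

noncomputable section

abbrev En (n : ℕ) := EuclideanSpace ℝ (Fin n)

/-- Standard inner product on ℝⁿ. -/
def dotp {n : ℕ} (x y : En n) : ℝ := ∑ i, x i * y i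

/-- Closed positive orthant R̄₊ⁿ. -/
def posOrthantCl (n : ℕ) : Set (En n) := {x | ∀ i, 0 ≤ x i}
/-- Open positive orthant R₊ⁿ. -/
def posOrthantOp (n : ℕ) : Set (En n) := {x | ∀ i, 0 < x i}
/-- Closed negative orthant R̄₋ⁿ. -/
def negOrthantCl (n : ℕ) : Set (En n) := {x | ∀ i, x i ≤ 0}
/-- Open negative orthant R₋ⁿ. -/
def negOrthantOp (n : ℕ) : Set (En n) := {x | ∀ i, x i < 0}

/-- Copolar A° = {x : ⟨x,y⟩ ≤ −1 for all y ∈ A}. -/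
def copolar {n : ℕ} (A : Set (En n)) : Set (En n) := {x | ∀ y ∈ A, dotp x y ≤ -1}

/-- Membership in C₊: closed convex subset of R̄₊ⁿ with A + R₊ⁿ ⊆ A. -/
def memCplus {n : ℕ} (A : Set (En n)) : Prop :=
  IsClosed A ∧ Convex ℝ A ∧ A ⊆ posOrthantCl n ∧ A + posOrthantOp n ⊆ A

/-- Membership in C₋: closed convex subset of R̄₋ⁿ with A + R₋ⁿ ⊆ A. -/
def memCminus {n : ℕ} (A : Set (En n)) : Prop :=
  IsClosed A ∧ Convex ℝ A ∧ A ⊆ negOrthantCl n ∧ A + negOrthantOp n ⊆ A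

/-- Membership in CC₊: member of C₊ with bounded complement in R̄₊ⁿ. -/
def memCCplus {n : ℕ} (P : Set (En n)) : Prop :=
  memCplus P ∧ Bornology.IsBounded (posOrthantCl n \ P)

/-- Membership in UC₋: nonempty member of C₋ contained in s* + R̄₋ⁿ for some s* ∈ R₋ⁿ. -/
def memUCminus {n : ℕ} (L : Set (En n)) : Prop :=
  L.Nonempty ∧ memCminus L ∧ ∃ s ∈ negOrthantOp n, L ⊆ s +ᵥ negOrthantCl n

/-- Support function of a set, with values in EReal. -/
def suppFn {n : ℕ} (A : Set (En n)) (x : En n) : EReal := ⨆ y ∈ A, ((dotp x y : ℝ) : EReal)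

/-- Legendre transform of an EReal-valued function. -/
def legendre {n : ℕ} (f : En n → EReal) (y : En n) : EReal :=
  ⨆ x, ((dotp x y : ℝ) : EReal) - f x

lemma dotp_eq_inner {n : ℕ} (x y : En n) : dotp x y = inner ℝ x y := by
  simp [dotp, PiLp.inner_apply, mul_comm]

lemma dotp_comm {n : ℕ} (x y : En n) : dotp x y = dotp y x := by
  simp [dotp, mul_comm]

lemma dotp_smul_left {n : ℕ} (t : ℝ) (x y : En n) : dotp (t • x) y = t * dotp x y := by
  simp [dotp, Finset.mul_sum, mul_assoc]

lemma dotp_add_left {n : ℕ} (x y z : En n) : dotp (x + y) z = dotp x z + dotp y z := by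
  simp [dotp, add_mul, Finset.sum_add_distrib]

lemma dotp_single_left {n : ℕ} (i : Fin n) (a : ℝ) (y : En n) :
    dotp (EuclideanSpace.single i a) y = a * y i := by
  simp [dotp]

lemma dotp_nonpos {n : ℕ} {x y : En n} (hx : x ∈ negOrthantCl n) (hy : y ∈ posOrthantCl n) :
    dotp x y ≤ 0 :=
  Finset.sum_nonpos fun i _ => mul_nonpos_of_nonpos_of_nonneg (hx i) (hy i)

/-- A linear function bounded above along a ray is nonincreasing in its direction. -/
lemma dotp_nonpos_of_ray_bounded {n : ℕ} {z v p : En n} {a : ℝ}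
    (h : ∀ t : ℝ, 0 ≤ t → dotp (z + t • v) p ≤ a) : dotp v p ≤ 0 := by
  by_contra! hv
  have h0 := h 0 le_rfl
  have h1 := h ((a - dotp z p + 1) / dotp v p)
    (div_nonneg (by simp at h0; linarith) hv.le)
  rw [dotp_add_left, dotp_smul_left, div_mul_cancel₀ _ hv.ne'] at h1
  linarith

lemma smul_single_mem_negOrthantCl {n : ℕ} (i : Fin n) {t : ℝ} (ht : 0 ≤ t) :
    t • (EuclideanSpace.single i (-1) : En n) ∈ negOrthantCl n := by
  intro j
  by_cases h : j = i <;> simp [h, ht]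

lemma memCminus.add_mem {n : ℕ} {L : Set (En n)} (hL : memCminus L) {z w : En n}
    (hz : z ∈ L) (hw : w ∈ negOrthantCl n) : z + w ∈ L := by
  let e : En n := WithLp.toLp 2 fun _ => 1
  have hlim : Filter.Tendsto (fun k : ℕ => z + (w - (1 / ((k : ℝ) + 1)) • e))
      Filter.atTop (nhds (z + (w - (0 : ℝ) • e))) :=
    ((tendsto_one_div_add_atTop_nhds_zero_nat.smul_const e).const_sub w).const_add z
  rw [zero_smul, sub_zero] at hlim
  refine hL.1.mem_of_tendsto hlim (Filter.Eventually.of_forall fun k => ?_)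
  refine hL.2.2.2 (Set.add_mem_add hz fun i => ?_)
  have hk : (0 : ℝ) < 1 / ((k : ℝ) + 1) := by positivity
  have hi := hw i
  have he : (w - (1 / ((k : ℝ) + 1)) • e) i = w i - 1 / ((k : ℝ) + 1) := by simp [e]
  rw [he]
  linarith

lemma memCminus.mem_posOrthantCl_of_bounded {n : ℕ} {L : Set (En n)} (hL : memCminus L)
    (hne : L.Nonempty) {p : En n} {a : ℝ} (h : ∀ z ∈ L, dotp z p ≤ a) : p ∈ posOrthantCl n := by
  obtain ⟨z, hz⟩ := hne
  intro i
  have := dotp_nonpos_of_ray_bounded (v := EuclideanSpace.single i (-1)) fun t ht =>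
    h _ (hL.add_mem hz (smul_single_mem_negOrthantCl i ht))
  rw [dotp_single_left] at this
  linarith

lemma copolar_add_mem {n : ℕ} {L : Set (En n)} (hL : L ⊆ negOrthantCl n) {p w : En n}
    (hp : p ∈ copolar L) (hw : w ∈ posOrthantCl n) : p + w ∈ copolar L := by
  intro z hz
  have := dotp_nonpos (hL hz) hw
  rw [dotp_add_left, dotp_comm w]
  linarith [hp z hz]

lemma memUCminus.copolar_nonempty {n : ℕ} (hn : 1 ≤ n) {L : Set (En n)} (hL : memUCminus L) :
    (copolar L).Nonempty := by
  obtain ⟨-, -, s, hs, hLs⟩ := hL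
  refine ⟨WithLp.toLp 2 fun i => -(s i)⁻¹, fun z hz => ?_⟩
  have hle : ∀ i, z i ≤ s i := by
    obtain ⟨w, hw, rfl⟩ := hLs hz
    intro i
    have := hw i
    simp only [vadd_eq_add, PiLp.add_apply]
    linarith
  have hterm : ∀ i ∈ Finset.univ, -(s i)⁻¹ * z i ≤ -1 := by
    intro i _
    have h1 : 0 < -(s i)⁻¹ := neg_pos.mpr (inv_lt_zero.mpr (hs i))
    calc -(s i)⁻¹ * z i ≤ -(s i)⁻¹ * s i := mul_le_mul_of_nonneg_left (hle i) h1.le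
      _ = -1 := by rw [neg_mul, inv_mul_cancel₀ (hs i).ne]
  have hsum := Finset.sum_le_sum hterm
  have hn' : (1 : ℝ) ≤ n := by exact_mod_cast hn
  simp only [Finset.sum_const, Finset.card_univ, Fintype.card_fin, nsmul_eq_mul] at hsum
  unfold dotp
  linarith

lemma mem_negOrthantCl_of_bounded_copolar {n : ℕ} {L : Set (En n)} (hL : L ⊆ negOrthantCl n)
    (hne : (copolar L).Nonempty) {x : En n} {a : ℝ} (h : ∀ p ∈ copolar L, dotp x p ≤ a) :
    x ∈ negOrthantCl n := by
  obtain ⟨p, hp⟩ := hne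
  intro i
  have := dotp_nonpos_of_ray_bounded (v := EuclideanSpace.single i 1) fun t ht => by
    refine (dotp_comm _ _).trans_le (h (p + t • EuclideanSpace.single i 1)
      (copolar_add_mem hL hp fun j => ?_))
    by_cases hj : j = i <;> simp [hj, ht]
  rw [dotp_single_left] at this
  linarith

/-- The bipolar theorem for the copolar. -/
lemma memCminus.mem_of_copolar_le {n : ℕ} {L : Set (En n)} (hL : memCminus L)
    (hne : L.Nonempty) {x : En n} (hx : x ∈ negOrthantCl n)
    (h : ∀ p ∈ copolar L, dotp x p ≤ -1) : x ∈ L := by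
  by_contra hxL
  obtain ⟨f, a, hf, hfx⟩ := geometric_hahn_banach_closed_point hL.2.1 hL.1 hxL
  set u : En n := (InnerProductSpace.toDual ℝ (En n)).symm f
  have hu : ∀ z, f z = dotp z u := fun z => by
    rw [dotp_comm, dotp_eq_inner, InnerProductSpace.toDual_symm_apply]
  simp only [hu] at hf hfx
  have hupos := hL.mem_posOrthantCl_of_bounded hne fun z hz => (hf z hz).le
  have ha : a < 0 := hfx.trans_le (dotp_nonpos hx hupos)
  have hinv : 0 < (-a)⁻¹ := inv_pos.mpr (neg_pos.mpr ha)
  have hscale : (-a)⁻¹ * a = -1 := by rw [inv_neg, neg_mul, inv_mul_cancel₀ ha.ne]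
  have hmem : (-a)⁻¹ • u ∈ copolar L := fun z hz => by
    rw [dotp_smul_left, dotp_comm, ← hscale]
    exact mul_le_mul_of_nonneg_left (hf z hz).le hinv.le
  have hle := h _ hmem
  rw [dotp_comm, dotp_smul_left, dotp_comm, ← hscale] at hle
  exact hle.not_gt (mul_lt_mul_of_pos_left hfx hinv)

lemma dotp_le_suppFn {n : ℕ} {A : Set (En n)} {z : En n} (hz : z ∈ A) (x : En n) :
    ((dotp x z : ℝ) : EReal) ≤ suppFn A x :=
  le_iSup₂ (f := fun y (_ : y ∈ A) => ((dotp x y : ℝ) : EReal)) z hz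

lemma suppFn_le_iff {n : ℕ} {A : Set (En n)} {x : En n} {a : ℝ} :
    suppFn A x ≤ (a : EReal) ↔ ∀ z ∈ A, dotp x z ≤ a := by
  simp [suppFn]

lemma memCminus.suppFn_eq_top {n : ℕ} {L : Set (En n)} (hL : memCminus L)
    (hne : L.Nonempty) {y : En n} (hy : y ∉ posOrthantCl n) : suppFn L y = ⊤ := by
  rw [EReal.eq_top_iff_forall_lt]
  intro a
  by_contra! h
  exact hy (hL.mem_posOrthantCl_of_bounded hne fun z hz =>
    (dotp_comm z y).trans_le (suppFn_le_iff.mp h z hz))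

/-- For L ∈ UC₋, the Legendre transform of f = max{h_{L°}, −1}
is 𝓛[f] = max{h_L + 1, 0}. -/
theorem legendre_cutoff (n : ℕ) (hn : 1 ≤ n) (L : Set (En n)) (hL : memUCminus L) :
    ∀ y : En n,
      legendre (fun x => max (suppFn (copolar L) x) (-1 : EReal)) y
        = max (suppFn L y + 1) 0 := by
  intro y
  have hC := hL.2.1
  have hne := hL.1
  have hcne := hL.copolar_nonempty hn
  have hbot : (1 : EReal) ≠ ⊥ := EReal.coe_ne_bot 1
  have htop : (1 : EReal) ≠ ⊤ := EReal.coe_ne_top 1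
  have hneg : (-1 : EReal) = ((-1 : ℝ) : EReal) := by simp
  apply le_antisymm
  · refine iSup_le fun x => ?_
    obtain ⟨c, hc⟩ | hc : (∃ c : ℝ, max (suppFn (copolar L) x) (-1 : EReal) = c) ∨
        max (suppFn (copolar L) x) (-1 : EReal) = ⊤ := by
      induction hm : max (suppFn (copolar L) x) (-1 : EReal) with
      | bot => exact absurd (le_bot_iff.mp ((le_max_right _ _).trans_eq hm)) (by decide)
      | coe c => exact Or.inl ⟨c, rfl⟩
      | top => exact Or.inr rfl
    · have hxc := suppFn_le_iff.mp ((le_max_left _ _).trans_eq hc)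
      have hc1 : -1 ≤ c := by
        rw [← EReal.coe_le_coe_iff, ← hneg]
        exact (le_max_right _ _).trans_eq hc
      have hx := mem_negOrthantCl_of_bounded_copolar hC.2.2.1 hcne hxc
      simp only [hc]
      rcases le_or_gt 0 c with hc0 | hc0
      · by_cases hy : y ∈ posOrthantCl n
        · refine le_max_of_le_right ?_
          have := dotp_nonpos hx hy
          exact_mod_cast (by linarith : dotp x y - c ≤ 0)
        · simp [hC.suppFn_eq_top hne hy, EReal.top_add_of_ne_bot hbot]
      · have hinv : 0 < (-c)⁻¹ := inv_pos.mpr (neg_pos.mpr hc0)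
        have hz : (-c)⁻¹ • x ∈ L := by
          refine hC.mem_of_copolar_le hne (fun i => ?_) fun p hp => ?_
          · exact mul_nonpos_of_nonneg_of_nonpos hinv.le (hx i)
          · calc dotp ((-c)⁻¹ • x) p = (-c)⁻¹ * dotp x p := dotp_smul_left _ _ _
              _ ≤ (-c)⁻¹ * c := mul_le_mul_of_nonneg_left (hxc p hp) hinv.le
              _ = -1 := by rw [inv_neg, neg_mul, inv_mul_cancel₀ hc0.ne]
        have hxz : dotp x y = -c * dotp y ((-c)⁻¹ • x) := by
          rw [dotp_comm y, dotp_smul_left, mul_inv_cancel_left₀ (neg_ne_zero.mpr hc0.ne)]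
        have hreal : dotp x y - c ≤ max (dotp y ((-c)⁻¹ • x) + 1) 0 := by
          rw [hxz]
          rcases le_total 0 (dotp y ((-c)⁻¹ • x) + 1) with h | h
          · exact le_max_of_le_left (by nlinarith)
          · exact le_max_of_le_right (by nlinarith)
        calc ((dotp x y : ℝ) : EReal) - c ≤ max (((dotp y ((-c)⁻¹ • x) : ℝ) : EReal) + 1) 0 := by
              rw [le_max_iff] at hreal ⊢
              exact_mod_cast hreal
          _ ≤ _ := max_le_max_right _ (add_le_add_left (dotp_le_suppFn hz y) 1)
    · simp [hc]
  · refine max_le ?_ ?_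
    · rw [← EReal.le_sub_iff_add_le (Or.inl hbot) (Or.inl htop)]
      refine iSup₂_le fun z hz => ?_
      rw [EReal.le_sub_iff_add_le (Or.inl hbot) (Or.inl htop)]
      refine le_trans ?_ (le_iSup _ z)
      have hsupp : suppFn (copolar L) z ≤ -1 :=
        hneg ▸ suppFn_le_iff.mpr fun p hp => (dotp_comm z p).trans_le (hp z hz)
      simp only [max_eq_right hsupp, dotp_comm y z, sub_eq_add_neg, neg_neg, le_refl]
    · refine le_trans ?_ (le_iSup _ 0)
      have h0 : suppFn (copolar L) 0 ≤ ((0 : ℝ) : EReal) :=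
        suppFn_le_iff.mpr fun p _ => by simp [dotp]
      have hmax : max (suppFn (copolar L) 0) (-1 : EReal) ≤ 0 :=
        max_le (by exact_mod_cast h0) (by
          rw [hneg]
          exact_mod_cast (by norm_num : (-1 : ℝ) ≤ 0))
      have hd : dotp (0 : En n) y = 0 := by simp [dotp]
      simpa [hd, sub_eq_add_neg] using hmax
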